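/- arXiv:2305.08260 — 5 statements merged into one kernel-verified Lean document; each statement's English description precedes it below -/
import Mathlib

section
/- Let W be an ℓ-dimensional linear subspace of ℝ^n that is spanned by vectors in ℚ^n. Then there exists a linear map L : ℝ^ℓ → ℝ^n such that L(ℝ^ℓ) = W, L(ℤ^ℓ) ⊆ ℤ^n, L^{-1}(ℤ^n) = ℤ^ℓ, and L^{-1}(ℝ^n_+) ⊆ ℝ^ℓ_+. -/
/-- A nonzero integer-valued functional attains the positive generator of its range. -/
lemma exists_pos_generator_of_ne_zero {M : Type*} [AddCommGroup M] [Module ℤ M]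
    (s : M →ₗ[ℤ] ℤ) (hs : s ≠ 0) : ∃ w, 0 < s w ∧ ∀ z, s w ∣ s z := by
  obtain ⟨g, hg⟩ := (IsPrincipalIdealRing.principal (LinearMap.range s)).principal
  have hdvd : ∀ z, g ∣ s z := fun z ↦ by
    have : s z ∈ Submodule.span ℤ {g} := hg ▸ LinearMap.mem_range_self s z
    exact Ideal.mem_span_singleton.1 this
  obtain ⟨w, hw⟩ : g ∈ LinearMap.range s := hg ▸ Submodule.mem_span_singleton_self g
  have hg0 : g ≠ 0 := by
    rintro rfl
    exact hs (LinearMap.ext fun z ↦ zero_dvd_iff.1 (hdvd z))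
  rcases lt_or_gt_of_ne hg0 with h | h
  · exact ⟨-w, by simp [hw, h], fun z ↦ by simpa [hw] using hdvd z⟩
  · exact ⟨w, hw ▸ h, fun z ↦ hw ▸ hdvd z⟩

open Module in
/-- If a functional `S`, integral on a lattice, dominates the norm on a set `C`, then the lattice has
a basis in which all points of `C` have nonnegative coordinates. -/
lemma exists_basis_repr_nonneg {E : Type*} [NormedAddCommGroup E] [NormedSpace ℝ E]
    [FiniteDimensional ℝ E] (Λ : Submodule ℤ E) [DiscreteTopology Λ] [IsZLattice ℝ Λ]
    {ℓ : ℕ} (hℓ : finrank ℝ E = ℓ) (S : E →ₗ[ℝ] ℝ) (hS : ∀ z ∈ Λ, ∃ m : ℤ, S z = m)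
    (C : Set E) (hC : ∀ z ∈ C, ‖z‖ ≤ S z) :
    ∃ b : Basis (Fin ℓ) ℤ Λ, ∀ z ∈ C, ∀ k, 0 ≤ (b.ofZLatticeBasis ℝ Λ).repr z k := by
  have : Module.Finite ℤ Λ := ZLattice.module_finite ℝ Λ
  have : Module.Free ℤ Λ := ZLattice.module_free ℝ Λ
  have hrank : finrank ℤ Λ = ℓ := (ZLattice.rank ℝ Λ).trans hℓ
  choose f hf using hS
  let s : Λ →ₗ[ℤ] ℤ := AddMonoidHom.toIntLinearMap
    { toFun := fun z ↦ f z z.2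
      map_zero' := by
        have := hf 0 Λ.zero_mem
        rw [map_zero] at this
        exact_mod_cast this.symm
      map_add' := fun x y ↦ by
        have := hf _ (x + y).2
        have h : S (x + y : Λ) = S x + S y := map_add S _ _
        rw [this, hf _ x.2, hf _ y.2] at h
        exact_mod_cast h }
  have hs : ∀ z : Λ, (s z : ℝ) = S z := fun z ↦ (hf z z.2).symm
  by_cases hs0 : s = 0
  · refine ⟨finBasisOfFinrankEq ℤ Λ hrank, fun z hz k ↦ ?_⟩
    have hSz : S = 0 := by
      refine ((finBasisOfFinrankEq ℤ Λ hrank).ofZLatticeBasis ℝ Λ).ext fun i ↦ ?_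
      simp [← hs, hs0]
    have : z = 0 := by simpa [hSz] using hC z hz
    simp [this]
  obtain ⟨w, hw0, hw⟩ := exists_pos_generator_of_ne_zero s hs0
  have hw0' : (0 : ℝ) < s w := by exact_mod_cast hw0
  let k := finBasis ℤ (LinearMap.ker s)
  have hli : ∀ y, s y = s w → ∀ c : ℤ, ∀ x ∈ LinearMap.ker s, c • y + x = 0 → c = 0 := by
    intro y hy c x hx h
    have := congrArg s h
    rw [map_add, map_smul, hy, LinearMap.mem_ker.1 hx] at this
    simpa [hw0.ne'] using this
  have hsp : ∀ y, s y = s w → ∀ z, ∃ c : ℤ, z + c • y ∈ LinearMap.ker s := by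
    intro y hy z
    obtain ⟨t, ht⟩ := hw z
    refine ⟨-t, ?_⟩
    rw [LinearMap.mem_ker, map_add, map_smul, hy, ht, smul_eq_mul]
    ring
  let b₀ := Basis.mkFinCons w k (hli w rfl) (hsp w rfl)
  obtain rfl : finrank ℤ (LinearMap.ker s) + 1 = ℓ := by
    rw [← hrank, finrank_eq_card_basis b₀, Fintype.card_fin]
  let c := (b₀.ofZLatticeBasis ℝ Λ).equivFun.toLinearMap.toContinuousLinearMap
  obtain ⟨N, hN⟩ := exists_nat_ge (‖c‖ * s w)
  let y : Λ := w - (N : ℤ) • ∑ i, (k i : Λ)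
  have hy : s y = s w := by simp [y]
  let b := Basis.mkFinCons y k (hli y hy) (hsp y hy)
  refine ⟨b, fun z hz ↦ ?_⟩
  set B := b.ofZLatticeBasis ℝ Λ with hB
  have hB0 : B 0 = y := by simp [hB, b]
  have hBs : ∀ i : Fin _, B i.succ = (k i : Λ) := fun i ↦ by simp [hB, b]
  have hzsum : z = B.repr z 0 • (y : E) + ∑ i : Fin _, B.repr z i.succ • ((k i : Λ) : E) := by
    conv_lhs => rw [← B.sum_repr z, Fin.sum_univ_succ]
    simp only [hB0, hBs]
  have hSz : S z = B.repr z 0 * s w := by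
    conv_lhs => rw [hzsum]
    have : ∀ i, S ((k i : Λ) : E) = 0 := fun i ↦ by
      rw [← hs, LinearMap.mem_ker.1 (k i).2, Int.cast_zero]
    simp [this, ← hs, hy]
  have h0 : 0 ≤ B.repr z 0 := by
    have := (norm_nonneg z).trans (hC z hz)
    rw [hSz] at this
    exact nonneg_of_mul_nonneg_left this hw0'
  refine Fin.cases h0 fun i ↦ ?_
  have hcw : c w i.succ = 0 := by
    have : b₀ 0 = w := by simp [b₀]
    simp [c, ← this]
  have hck : ∀ j, c ((k j : Λ) : E) i.succ = if j = i then 1 else 0 := fun j ↦ by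
    have : b₀ j.succ = k j := by simp [b₀]
    simp [c, ← this, Finsupp.single_apply]
  have hcz : c z i.succ = - N * B.repr z 0 + B.repr z i.succ := by
    conv_lhs => rw [hzsum]
    simp [y, hcw, hck]
    ring
  have hle : |c z i.succ| ≤ N * B.repr z 0 := calc
    |c z i.succ| ≤ ‖c z‖ := norm_le_pi_norm (c z) i.succ
    _ ≤ ‖c‖ * ‖z‖ := c.le_opNorm z
    _ ≤ ‖c‖ * (B.repr z 0 * s w) := by
      rw [← hSz]
      exact mul_le_mul_of_nonneg_left (hC z hz) (norm_nonneg c)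
    _ = ‖c‖ * s w * B.repr z 0 := by ring
    _ ≤ N * B.repr z 0 := mul_le_mul_of_nonneg_right hN h0
  linarith [neg_abs_le (c z i.succ)]

/-- Clearing denominators in a rational vector. -/
lemma exists_pos_nat_mul_eq_int {ι : Type*} [Fintype ι] (x : ι → ℝ)
    (hx : ∀ j, ∃ q : ℚ, x j = q) : ∃ d : ℕ, 0 < d ∧ ∀ j, ∃ m : ℤ, d * x j = m := by
  choose q hq using hx
  refine ⟨∏ j, (q j).den, Finset.prod_pos fun j _ ↦ (q j).pos, fun j ↦ ?_⟩
  obtain ⟨e, he⟩ := Finset.dvd_prod_of_mem (fun j ↦ (q j).den) (Finset.mem_univ j)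
  refine ⟨(q j).num * e, ?_⟩
  have h : ((q j).den : ℝ) * q j = (q j).num := by exact_mod_cast Rat.den_mul_eq_num (q j)
  rw [he, hq]
  push_cast
  rw [← h]
  ring

/-- Let `W` be an `ℓ`-dimensional linear subspace of `ℝ^n` spanned by
vectors with rational coordinates. Then there exists a linear map `L : ℝ^ℓ → ℝ^n` such that
`L(ℝ^ℓ) = W`, `L(ℤ^ℓ) ⊆ ℤ^n`, `L⁻¹(ℤ^n) = ℤ^ℓ`, and `L⁻¹(ℝ^n₊) ⊆ ℝ^ℓ₊`. -/
theorem stmt_0 (n ℓ : ℕ) (W : Submodule ℝ (Fin n → ℝ))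
    (hdim : Module.finrank ℝ W = ℓ)
    (hrat : ∃ B : Set (Fin n → ℝ),
      (∀ x ∈ B, ∀ j, ∃ q : ℚ, x j = (q : ℝ)) ∧ Submodule.span ℝ B = W) :
    ∃ L : (Fin ℓ → ℝ) →ₗ[ℝ] (Fin n → ℝ),
      LinearMap.range L = W ∧
      (∀ x : Fin ℓ → ℝ, (∀ k, ∃ m : ℤ, x k = (m : ℝ)) → ∀ j, ∃ m : ℤ, L x j = (m : ℝ)) ∧
      (∀ x : Fin ℓ → ℝ, (∀ j, ∃ m : ℤ, L x j = (m : ℝ)) ↔ (∀ k, ∃ m : ℤ, x k = (m : ℝ))) ∧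
      (∀ x : Fin ℓ → ℝ, (∀ j, 0 ≤ L x j) → ∀ k, 0 ≤ x k) := by
  obtain ⟨R, hR, hspan⟩ := hrat
  let Z : Submodule ℤ (Fin n → ℝ) := Submodule.span ℤ (Set.range (Pi.basisFun ℝ (Fin n)))
  have hZ : ∀ x, x ∈ Z ↔ ∀ j, ∃ m : ℤ, x j = m := fun x ↦ by
    simp [Z, Module.Basis.mem_span_iff_repr_mem, eq_comm]
  let Λ : Submodule ℤ W := ZLattice.comap ℝ Z W.subtype
  have hΛ : ∀ x : W, x ∈ Λ ↔ ∀ j, ∃ m : ℤ, (x : Fin n → ℝ) j = m := fun x ↦ hZ x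
  have : DiscreteTopology Λ :=
    ZLattice.comap_discreteTopology ℝ Z continuous_subtype_val Subtype.val_injective
  have : IsZLattice ℝ Λ := by
    refine ⟨?_⟩
    rw [← (Submodule.map_injective_of_injective W.injective_subtype).eq_iff, Submodule.map_span,
      Submodule.map_top, Submodule.range_subtype]
    refine le_antisymm (Submodule.span_le.2 ?_) ?_
    · rintro _ ⟨x, -, rfl⟩
      exact x.2
    · refine hspan.ge.trans (Submodule.span_le.2 fun x hx ↦ ?_)
      obtain ⟨d, hd, hdx⟩ := exists_pos_nat_mul_eq_int x (hR x hx)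
      have hxW : x ∈ W := hspan ▸ Submodule.subset_span hx
      have hd' : (d : ℝ) ≠ 0 := by positivity
      rw [SetLike.mem_coe, ← Submodule.smul_mem_iff _ hd']
      exact Submodule.subset_span ⟨(d : ℝ) • ⟨x, hxW⟩, (hΛ _).2 hdx, rfl⟩
  obtain ⟨b, hb⟩ := exists_basis_repr_nonneg Λ hdim
    ((∑ j, LinearMap.proj j : (Fin n → ℝ) →ₗ[ℝ] ℝ) ∘ₗ W.subtype)
    (fun z hz ↦ by
      choose m hm using (hΛ z).1 hz
      exact ⟨∑ j, m j, by simp [hm]⟩)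
    {z | ∀ j, 0 ≤ (z : Fin n → ℝ) j}
    (fun z hz ↦ by
      have hz' : ∀ j, 0 ≤ (z : Fin n → ℝ) j := hz
      rw [Submodule.coe_norm, pi_norm_le_iff_of_nonneg
        (by simpa using Finset.sum_nonneg fun j _ ↦ hz' j)]
      intro i
      rw [Real.norm_of_nonneg (hz' i)]
      simpa using Finset.single_le_sum (fun j _ ↦ hz' j) (Finset.mem_univ i))
  let e := (b.ofZLatticeBasis ℝ Λ).equivFun
  have hint : ∀ x : Fin ℓ → ℝ, (∀ j, ∃ m : ℤ, (e.symm x : Fin n → ℝ) j = m) ↔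
      ∀ k, ∃ m : ℤ, x k = m := by
    intro x
    have hx : ∀ k, (b.ofZLatticeBasis ℝ Λ).repr (e.symm x) k = x k := fun k ↦
      congrFun (e.apply_symm_apply x) k
    rw [← hΛ, ← b.ofZLatticeBasis_span ℝ, Module.Basis.mem_span_iff_repr_mem]
    simp [hx, eq_comm]
  refine ⟨W.subtype ∘ₗ e.symm.toLinearMap, ?_, fun x ↦ (hint x).2, hint, fun x hx k ↦ ?_⟩
  · rw [LinearMap.range_comp, LinearEquiv.range, Submodule.map_top, Submodule.range_subtype]
  · have := hb (e.symm x) hx k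
    rwa [show (b.ofZLatticeBasis ℝ Λ).repr (e.symm x) k = x k from
      congrFun (e.apply_symm_apply x) k] at this
end

section
/- Let L : ℝ^ℓ → ℝ^n be an injective linear map such that L(ℤ^ℓ) ⊆ ℤ^n and L^{-1}(ℤ^n) = ℤ^ℓ. Then L^*(ℤ^n) = ℤ^ℓ, where L^* : ℝ^n → ℝ^ℓ is the adjoint of L with respect to the standard inner products. -/
/-- An injective linear map over a PID into a finite module has a left inverse as soon as its range
is saturated. -/
theorem LinearMap.exists_leftInverse_of_saturated_range {R M N : Type*} [CommRing R] [IsDomain R]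
    [IsPrincipalIdealRing R] [AddCommGroup M] [Module R M] [AddCommGroup N] [Module R N]
    [Module.Finite R N] (f : M →ₗ[R] N) (hf : Function.Injective f)
    (hsat : ∀ (a : R) (v : N), a ≠ 0 → a • v ∈ range f → v ∈ range f) :
    ∃ g : N →ₗ[R] M, g ∘ₗ f = LinearMap.id := by
  have : Module.IsTorsionFree R (N ⧸ range f) := by
    refine Module.IsTorsionFree.of_smul_eq_zero fun a q h ↦ ?_
    obtain ⟨v, rfl⟩ := (range f).mkQ_surjective q
    rw [← map_smul, Submodule.mkQ_apply, Submodule.Quotient.mk_eq_zero] at h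
    rw [Submodule.mkQ_apply, Submodule.Quotient.mk_eq_zero]
    exact or_iff_not_imp_left.mpr fun ha ↦ hsat a v ha h
  have hsplit := (Function.Exact.split_tfae f.exact_map_mkQ_range hf
    (range f).mkQ_surjective).out 0 1
  exact hsplit.mp (Module.projective_lifting_property _ LinearMap.id (range f).mkQ_surjective)

theorem LinearMap.apply_eq_sum_smul_apply_single {R M ι : Type*} [Semiring R] [AddCommMonoid M]
    [Module R M] [Fintype ι] [DecidableEq ι] (f : (ι → R) →ₗ[R] M) (x : ι → R) :
    f x = ∑ i, x i • f (Pi.single i 1) := by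
  conv_lhs => rw [← Finset.univ_sum_single x, map_sum]
  refine Finset.sum_congr rfl fun i _ ↦ ?_
  rw [← map_smul, ← Pi.single_smul, smul_eq_mul, mul_one]


/-- If `L : ℝ^ℓ → ℝ^n` is an injective linear map with `L(ℤ^ℓ) ⊆ ℤ^n` and
`L⁻¹(ℤ^n) = ℤ^ℓ`, then the adjoint `L*` (with respect to the standard inner products)
satisfies `L*(ℤ^n) = ℤ^ℓ`. -/
theorem stmt_1 (n ℓ : ℕ) (L : (Fin ℓ → ℝ) →ₗ[ℝ] (Fin n → ℝ))
    (Lstar : (Fin n → ℝ) →ₗ[ℝ] (Fin ℓ → ℝ))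
    (hinj : Function.Injective L)
    (hadj : ∀ (x : Fin ℓ → ℝ) (y : Fin n → ℝ), ∑ j, L x j * y j = ∑ k, x k * Lstar y k)
    (hZZ : ∀ x : Fin ℓ → ℝ, (∀ k, ∃ m : ℤ, x k = (m : ℝ)) → ∀ j, ∃ m : ℤ, L x j = (m : ℝ))
    (hpre : ∀ x : Fin ℓ → ℝ, (∀ j, ∃ m : ℤ, L x j = (m : ℝ)) ↔ (∀ k, ∃ m : ℤ, x k = (m : ℝ))) :
    Lstar '' {y : Fin n → ℝ | ∀ j, ∃ m : ℤ, y j = (m : ℝ)}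
      = {x : Fin ℓ → ℝ | ∀ k, ∃ m : ℤ, x k = (m : ℝ)} := by
  have hunit (k : Fin ℓ) : ∃ v : Fin n → ℤ, ∀ j, L (Pi.single k 1) j = v j := by
    refine Classical.skolem.mp (hZZ _ fun i ↦ ⟨(Pi.single k 1 : Fin ℓ → ℤ) i, ?_⟩)
    by_cases h : i = k <;> simp [h]
  choose A hA using hunit
  have hL (x : Fin ℓ → ℝ) (j : Fin n) : L x j = ∑ k, x k * A k j := by
    simp [L.apply_eq_sum_smul_apply_single x, hA]
  have hLstar (y : Fin n → ℝ) (k : Fin ℓ) : Lstar y k = ∑ j, A k j * y j := by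
    simpa [hA, Pi.single_apply] using (hadj (Pi.single k 1) y).symm
  let f : (Fin ℓ → ℤ) →ₗ[ℤ] (Fin n → ℤ) := Fintype.linearCombination ℤ A
  have hf (z : Fin ℓ → ℤ) (j : Fin n) : ((f z j : ℤ) : ℝ) = L (fun k ↦ (z k : ℝ)) j := by
    simp [hL, f, Fintype.linearCombination_apply]
  have hf_inj : Function.Injective f := fun z w hzw ↦ by
    have h : L (fun k ↦ (z k : ℝ)) = L (fun k ↦ (w k : ℝ)) :=
      funext fun j ↦ by rw [← hf, ← hf, hzw]
    exact funext fun k ↦ by exact_mod_cast congrFun (hinj h) k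
  obtain ⟨g, hg⟩ := f.exists_leftInverse_of_saturated_range hf_inj <| by
    rintro a v ha ⟨z, hz⟩
    have ha' : (a : ℝ) ≠ 0 := by exact_mod_cast ha
    have hv : L ((a : ℝ)⁻¹ • fun k ↦ (z k : ℝ)) = fun j ↦ (v j : ℝ) := by
      funext j
      rw [map_smul, Pi.smul_apply, ← hf, hz]
      simp [ha']
    choose m hm using (hpre _).mp fun j ↦ ⟨v j, congrFun hv j⟩
    refine ⟨m, funext fun j ↦ ?_⟩
    have h : (f m j : ℝ) = v j := by rw [hf, ← funext hm, hv]
    exact_mod_cast h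
  ext x
  constructor
  · rintro ⟨y, hy, rfl⟩ k
    choose m hm using hy
    exact ⟨∑ j, A k j * m j, by simp [hLstar, hm]⟩
  · intro hx
    choose m hm using hx
    let φ : (Fin n → ℤ) →ₗ[ℤ] ℤ := Fintype.linearCombination ℤ m ∘ₗ g
    have hφ (k : Fin ℓ) : φ (A k) = m k := by
      have hk : f (Pi.single k 1) = A k := by simp [f]
      have hgk := LinearMap.congr_fun hg (Pi.single k 1)
      rw [LinearMap.comp_apply, hk] at hgk
      simp [φ, hgk]
    refine ⟨fun j ↦ (φ (Pi.single j 1) : ℝ), fun j ↦ ⟨_, rfl⟩, funext fun k ↦ ?_⟩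
    rw [hLstar, hm, ← hφ, φ.apply_eq_sum_smul_apply_single]
    simp
end

section
/- Let a_1,…,a_ℓ ∈ ℤ^ℓ be linearly independent over ℝ and let Γ° be the closed convex cone generated by a_1,…,a_ℓ. Then there exist linearly independent vectors ξ_1,…,ξ_ℓ ∈ ℤ^ℓ ∩ Γ° such that the half-open parallelepiped P(ξ_1,…,ξ_ℓ) = {Σ_{k=1}^ℓ λ_k ξ_k : λ_k ∈ [0,1) for k = 1,…,ℓ} satisfies P(ξ_1,…,ξ_ℓ) ∩ ℤ^ℓ = {0}. -/
theorem linearIndependent_iff_det_ne_zero {ℓ : ℕ} (ξ : Fin ℓ → (Fin ℓ → ℝ)) :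
    LinearIndependent ℝ ξ ↔ (Matrix.of ξ).det ≠ 0 := by
  rw [← isUnit_iff_ne_zero, ← Matrix.isUnit_iff_isUnit_det,
    ← Matrix.linearIndependent_rows_iff_isUnit]
  rfl

theorem exists_natCast_eq_abs_det {ℓ : ℕ} (ξ : Fin ℓ → (Fin ℓ → ℝ))
    (hξ : ∀ k j, ∃ m : ℤ, ξ k j = (m : ℝ)) : ∃ n : ℕ, |(Matrix.of ξ).det| = (n : ℝ) := by
  choose m hm using hξ
  refine ⟨(Matrix.of m).det.natAbs, ?_⟩
  have h : Matrix.of ξ = (Matrix.of m).map (Int.castRingHom ℝ) := by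
    ext k j
    simp [hm]
  rw [h, ← RingHom.mapMatrix_apply, ← RingHom.map_det, Nat.cast_natAbs]
  simp

/-- A cone containing a linearly independent family of integer vectors contains one whose
half-open parallelepiped has no integer points besides the origin: replacing a generator by a
nonzero integer point of the parallelepiped lowers the absolute value of the determinant. -/
theorem exists_parallelepiped_inter_integers_eq_zero {ℓ : ℕ} (C : PointedCone ℝ (Fin ℓ → ℝ))
    (n : ℕ) (ξ : Fin ℓ → (Fin ℓ → ℝ)) (hn : |(Matrix.of ξ).det| = (n : ℝ))
    (hZ : ∀ k j, ∃ m : ℤ, ξ k j = (m : ℝ)) (hli : LinearIndependent ℝ ξ) (hC : ∀ k, ξ k ∈ C) :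
    ∃ ξ : Fin ℓ → (Fin ℓ → ℝ),
      (∀ k j, ∃ m : ℤ, ξ k j = (m : ℝ)) ∧
      LinearIndependent ℝ ξ ∧
      (∀ k, ξ k ∈ C) ∧
      ({x : Fin ℓ → ℝ | ∃ lam : Fin ℓ → ℝ, (∀ k, 0 ≤ lam k ∧ lam k < 1) ∧
          x = ∑ k, lam k • ξ k}
        ∩ {x : Fin ℓ → ℝ | ∀ j, ∃ m : ℤ, x j = (m : ℝ)}) = {0} := by
  induction n using Nat.strong_induction_on generalizing ξ with
  | _ n ih =>
    by_cases hP : ∀ lam : Fin ℓ → ℝ, (∀ k, 0 ≤ lam k ∧ lam k < 1) →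
        (∀ j, ∃ m : ℤ, (∑ k, lam k • ξ k) j = (m : ℝ)) → ∀ k, lam k = 0
    · refine ⟨ξ, hZ, hli, hC, Set.eq_singleton_iff_unique_mem.2 ⟨⟨⟨0, by simp, by simp⟩,
        fun j => ⟨0, by simp⟩⟩, ?_⟩⟩
      rintro _ ⟨⟨lam, hlam, rfl⟩, hx⟩
      simp [hP lam hlam hx]
    · push Not at hP
      obtain ⟨lam, hlam, hx, i, hi⟩ := hP
      set ξ' : Fin ℓ → (Fin ℓ → ℝ) := Function.update ξ i (∑ k, lam k • ξ k) with hξ'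
      have hdet : (Matrix.of ξ').det = lam i * (Matrix.of ξ).det :=
        Matrix.det_updateRow_sum (Matrix.of ξ) i lam
      have hne := (linearIndependent_iff_det_ne_zero ξ).1 hli
      have hZ' : ∀ k j, ∃ m : ℤ, ξ' k j = (m : ℝ) := by
        intro k
        rcases eq_or_ne k i with rfl | hk
        · simpa only [hξ', Function.update_self] using hx
        · simpa only [hξ', Function.update_of_ne hk] using hZ k
      obtain ⟨n', hn'⟩ := exists_natCast_eq_abs_det ξ' hZ'
      refine ih n' ?_ ξ' hn' hZ' ?_ ?_
      · rw [← Nat.cast_lt (α := ℝ), ← hn', ← hn, hdet, abs_mul, abs_of_nonneg (hlam i).1]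
        exact mul_lt_of_lt_one_left (abs_pos.2 hne) (hlam i).2
      · rw [linearIndependent_iff_det_ne_zero, hdet]
        exact mul_ne_zero hi hne
      · intro k
        rcases eq_or_ne k i with rfl | hk
        · rw [hξ', Function.update_self]
          exact C.sum_mem fun k _ => C.smul_mem (hlam k).1 (hC k)
        · rw [hξ', Function.update_of_ne hk]
          exact hC k

/-- Let `a 0, …, a (ℓ-1) ∈ ℤ^ℓ` be linearly independent over `ℝ` and let
`Γ°` be the closed convex cone generated by them (all nonnegative linear combinations).
Then there exist linearly independent vectors `ξ 0, …, ξ (ℓ-1) ∈ ℤ^ℓ ∩ Γ°` such that the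
half-open parallelepiped `P(ξ) = {Σ λ_k ξ_k : λ_k ∈ [0,1)}` satisfies `P(ξ) ∩ ℤ^ℓ = {0}`. -/
theorem stmt_3 (ℓ : ℕ) (a : Fin ℓ → (Fin ℓ → ℝ))
    (haZ : ∀ k j, ∃ m : ℤ, a k j = (m : ℝ))
    (hli : LinearIndependent ℝ a) :
    ∃ ξ : Fin ℓ → (Fin ℓ → ℝ),
      (∀ k j, ∃ m : ℤ, ξ k j = (m : ℝ)) ∧
      LinearIndependent ℝ ξ ∧
      (∀ k, ∃ μ : Fin ℓ → ℝ, (∀ i, 0 ≤ μ i) ∧ ξ k = ∑ i, μ i • a i) ∧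
      ({x : Fin ℓ → ℝ | ∃ lam : Fin ℓ → ℝ, (∀ k, 0 ≤ lam k ∧ lam k < 1) ∧
          x = ∑ k, lam k • ξ k}
        ∩ {x : Fin ℓ → ℝ | ∀ j, ∃ m : ℤ, x j = (m : ℝ)}) = {0} := by
  obtain ⟨n, hn⟩ := exists_natCast_eq_abs_det a haZ
  obtain ⟨ξ, hZ, hξ, hC, hP⟩ := exists_parallelepiped_inter_integers_eq_zero
    (PointedCone.hull ℝ (Set.range a)) n a hn haZ hli
    fun k => Submodule.subset_span (Set.mem_range_self k)
  refine ⟨ξ, hZ, hξ, fun k => ?_, hP⟩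
  obtain ⟨c, hc⟩ := (Submodule.mem_span_range_iff_exists_fun _).1 (hC k)
  exact ⟨fun i => c i, fun i => (c i).2, hc.symm⟩
end

section
/- Let η_1,…,η_n ∈ ℤ^n be such that: (i) η_1,…,η_ℓ are linearly independent over ℝ; (ii) the map ℤ^n → ℤ^ℓ, x ↦ (⟨η_1,x⟩,…,⟨η_ℓ,x⟩), is surjective onto ℤ^ℓ; and (iii) η_{ℓ+1},…,η_n form an ℝ-basis of the orthogonal complement in ℝ^n of span_ℝ(η_1,…,η_ℓ). Let F : (ℂ*)^n → (ℂ*)^ℓ be defined by F(z) = (z^{η_1},…,z^{η_ℓ}). Then for every z ∈ (ℂ*)^n, the fiber of F through z is exactly { ζ ∈ (ℂ*)^n : ζ_j = z_j · ∏_{k=ℓ+1}^n t_k^{η_{k,j}} for j = 1,…,n, for some (t_{ℓ+1},…,t_n) ∈ (ℂ*)^{n−ℓ} }, where η_{k,j} denotes the j-th coordinate of η_k. -/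
/-- If a product of integer powers of exponentials equals `1`, then the corresponding integer
combination of the exponents is an integer multiple of `2πi`. -/
theorem exists_int_of_prod_exp_zpow_eq_one {ι : Type*} [Fintype ι] (a : ι → ℤ) (u : ι → ℂ)
    (h : ∏ j, Complex.exp (u j) ^ a j = 1) :
    ∃ c : ℤ, ∑ j, (a j : ℂ) * u j = c * (2 * Real.pi * Complex.I) := by
  rw [← Complex.exp_eq_one_iff, Complex.exp_sum, ← h]
  exact Finset.prod_congr rfl fun j _ => Complex.exp_int_mul _ _

/-- If the real solutions of an integral linear system are spanned by integral vectors `θ i`, then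
every complex solution is a complex combination of the `θ i`. -/
theorem exists_complex_combination {ι κ μ : Type*} [Fintype ι] [Fintype μ]
    (η : κ → ι → ℤ) (θ : μ → ι → ℤ)
    (hθ : ∀ y : ι → ℝ, (∀ k, ∑ j, (η k j : ℝ) * y j = 0) →
      y ∈ Submodule.span ℝ (Set.range (fun i => fun j => (θ i j : ℝ))))
    (v : ι → ℂ) (hv : ∀ k, ∑ j, (η k j : ℂ) * v j = 0) :
    ∃ s : μ → ℂ, ∀ j, v j = ∑ i, (θ i j : ℂ) * s i := by
  have hre := hθ (fun j => (v j).re) fun k => by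
    simpa using congrArg Complex.re (hv k)
  have him := hθ (fun j => (v j).im) fun k => by
    simpa using congrArg Complex.im (hv k)
  obtain ⟨a, ha⟩ := (Submodule.mem_span_range_iff_exists_fun ℝ).1 hre
  obtain ⟨b, hb⟩ := (Submodule.mem_span_range_iff_exists_fun ℝ).1 him
  refine ⟨fun i => ⟨a i, b i⟩, fun j => Complex.ext ?_ ?_⟩
  · simpa [mul_comm] using (congrFun ha j).symm
  · simpa [mul_comm] using (congrFun hb j).symm

/-- The kernel of a monomial map with surjective exponent map is parametrized by monomials. -/
theorem exists_torus_parameter {ι κ μ : Type*} [Fintype ι] [Fintype μ]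
    (η : κ → ι → ℤ) (θ : μ → ι → ℤ)
    (hsurj : ∀ c : κ → ℤ, ∃ x : ι → ℤ, ∀ k, ∑ j, η k j * x j = c k)
    (hθ : ∀ y : ι → ℝ, (∀ k, ∑ j, (η k j : ℝ) * y j = 0) →
      y ∈ Submodule.span ℝ (Set.range (fun i => fun j => (θ i j : ℝ))))
    (w : ι → ℂ) (hw : ∀ j, w j ≠ 0) (h : ∀ k, ∏ j, w j ^ η k j = 1) :
    ∃ t : μ → ℂ, (∀ i, t i ≠ 0) ∧ ∀ j, w j = ∏ i, t i ^ θ i j := by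
  have hexp : ∀ j, Complex.exp (Complex.log (w j)) = w j := fun j => Complex.exp_log (hw j)
  choose c hc using fun k => exists_int_of_prod_exp_zpow_eq_one (η k)
    (fun j => Complex.log (w j)) (by simpa only [hexp] using h k)
  obtain ⟨x, hx⟩ := hsurj c
  obtain ⟨s, hs⟩ := exists_complex_combination η θ hθ
    (fun j => Complex.log (w j) - x j * (2 * Real.pi * Complex.I)) fun k => by
      simp only [mul_sub, Finset.sum_sub_distrib, hc, ← hx, ← mul_assoc, ← Finset.sum_mul]
      push_cast
      ring
  refine ⟨fun i => Complex.exp (s i), fun i => Complex.exp_ne_zero _, fun j => ?_⟩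
  simp only [← Complex.exp_int_mul, ← Complex.exp_sum, ← hs]
  rw [Complex.exp_sub, Complex.exp_int_mul_two_pi_mul_I, div_one, hexp]

/-- Monomials with exponents orthogonal to `a` are killed by the character with exponent `a`. -/
theorem prod_prod_zpow_zpow_eq_one {ι μ : Type*} [Fintype ι] [Fintype μ]
    (a : ι → ℤ) (θ : μ → ι → ℤ) (h : ∀ i, ∑ j, a j * θ i j = 0)
    (t : μ → ℂ) (ht : ∀ i, t i ≠ 0) :
    ∏ j, (∏ i, t i ^ θ i j) ^ a j = 1 := by
  simp only [← Finset.prod_zpow, ← zpow_mul]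
  rw [Finset.prod_comm]
  refine Finset.prod_eq_one fun i _ => ?_
  have hsum : ∀ S : Finset ι, ∏ j ∈ S, t i ^ (θ i j * a j) = t i ^ ∑ j ∈ S, θ i j * a j := by
    intro S
    induction S using Finset.cons_induction with
    | empty => simp
    | cons j S hj ih => rw [Finset.prod_cons, Finset.sum_cons, zpow_add₀ (ht i), ih]
  rw [hsum]
  simp only [mul_comm (θ i _), h, zpow_zero]


/-- Let `η 0,…, η (ℓ-1) ∈ ℤ^n` be linearly independent over `ℝ`, assume the
map `ℤ^n → ℤ^ℓ`, `x ↦ (⟨η k, x⟩)_k`, is surjective, and let `θ 0, …, θ (m-1) ∈ ℤ^n` be an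
`ℝ`-basis of the orthogonal complement of `span_ℝ(η)` in `ℝ^n`. Let
`F(z) = (z^{η 0}, …, z^{η (ℓ-1)})` on `(ℂ*)^n`. Then for every `z ∈ (ℂ*)^n` the fiber of `F`
through `z` is exactly `{ζ ∈ (ℂ*)^n : ζ j = z j * ∏ i, (t i)^(θ i j), t ∈ (ℂ*)^m}`. -/
theorem stmt_6 (n ℓ m : ℕ) (η : Fin ℓ → (Fin n → ℤ)) (θ : Fin m → (Fin n → ℤ))
    (hli : LinearIndependent ℝ (fun k => fun j => (η k j : ℝ)))
    (hsurj : ∀ c : Fin ℓ → ℤ, ∃ x : Fin n → ℤ, ∀ k, ∑ j, η k j * x j = c k)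
    (hθli : LinearIndependent ℝ (fun i => fun j => (θ i j : ℝ)))
    (hθspan : ∀ y : Fin n → ℝ,
      y ∈ Submodule.span ℝ (Set.range (fun i => fun j => (θ i j : ℝ))) ↔
        ∀ k, ∑ j, (η k j : ℝ) * y j = 0) :
    ∀ z : Fin n → ℂ, (∀ j, z j ≠ 0) →
      ∀ ζ : Fin n → ℂ,
        ((∀ j, ζ j ≠ 0) ∧ ∀ k, (∏ j, ζ j ^ η k j) = ∏ j, z j ^ η k j) ↔
        (∃ t : Fin m → ℂ, (∀ i, t i ≠ 0) ∧ ∀ j, ζ j = z j * ∏ i, t i ^ θ i j) := by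
  intro z hz ζ
  constructor
  · rintro ⟨hζ, h⟩
    obtain ⟨t, ht, hw⟩ := exists_torus_parameter η θ hsurj (fun y hy => (hθspan y).2 hy)
      (fun j => ζ j / z j) (fun j => div_ne_zero (hζ j) (hz j)) fun k => by
        simp only [div_zpow, Finset.prod_div_distrib, h]
        exact div_self (Finset.prod_ne_zero_iff.2 fun j _ => zpow_ne_zero _ (hz j))
    exact ⟨t, ht, fun j => by rw [← hw j, mul_div_cancel₀ _ (hz j)]⟩
  · rintro ⟨t, ht, h⟩
    refine ⟨fun j => ?_, fun k => ?_⟩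
    · rw [h j]
      exact mul_ne_zero (hz j) (Finset.prod_ne_zero_iff.2 fun i _ => zpow_ne_zero _ (ht i))
    · have horth : ∀ i, ∑ j, η k j * θ i j = 0 := fun i => by
        have hr := (hθspan (fun j => (θ i j : ℝ))).1 (Submodule.subset_span ⟨i, rfl⟩) k
        exact_mod_cast hr
      simp only [h, mul_zpow, Finset.prod_mul_distrib,
        prod_prod_zpow_zpow_eq_one (η k) θ horth t ht, mul_one]
end

section
/- Let S ⊆ ℝ^n_+ be a nonempty compact set, let s_0 ∈ ℝ^n and ρ_0 > 0 with the closed ball B̄(s_0, 2ρ_0) contained in S, and let z_0 ∈ ℂ^n. Then there exists a constant c_0 ∈ ℝ such that for every t ∈ B̄(s_0, ρ_0) and every z ∈ (ℂ*)^n with z ≠ z_0: ρ_0 log|z − z_0| + Σ_{j=1}^n t_j log|z_j| + c_0 ≤ φ_S(Log z). -/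
open Metric

/-- The Euclidean norm is at most `√n` times any bound on the moduli of the coordinates. -/
theorem EuclideanSpace.norm_le_sqrt_mul {n : ℕ} (z : EuclideanSpace ℂ (Fin n)) {r : ℝ}
    (hr : 0 ≤ r) (h : ∀ j, ‖z j‖ ≤ r) : ‖z‖ ≤ √n * r := by
  rw [EuclideanSpace.norm_eq, ← Real.sqrt_sq hr, ← Real.sqrt_mul (Nat.cast_nonneg n)]
  refine Real.sqrt_le_sqrt ?_
  calc ∑ j, ‖z j‖ ^ 2 ≤ ∑ _j : Fin n, r ^ 2 :=
        Finset.sum_le_sum fun j _ => pow_le_pow_left₀ (norm_nonneg _) (h j) 2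
    _ = n * r ^ 2 := by simp

/-- Let `S ⊆ ℝ^n₊` be nonempty compact, `s₀ ∈ ℝ^n`, `ρ₀ > 0` with
`B̄(s₀, 2ρ₀) ⊆ S`, and `z₀ ∈ ℂ^n`. Then there exists `c₀ ∈ ℝ` such that for every
`t ∈ B̄(s₀, ρ₀)` and every `z ∈ (ℂ*)^n` with `z ≠ z₀`:
`ρ₀ log|z − z₀| + Σ_j t_j log|z_j| + c₀ ≤ φ_S(Log z) = sup_{s ∈ S} Σ_j s_j log|z_j|`.
All norms are Euclidean. -/
theorem stmt_16 (n : ℕ) (S : Set (EuclideanSpace ℝ (Fin n)))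
    (hS : IsCompact S) (hSne : S.Nonempty) (hSpos : ∀ s ∈ S, ∀ j, 0 ≤ s j)
    (s₀ : EuclideanSpace ℝ (Fin n)) (ρ₀ : ℝ) (hρ₀ : 0 < ρ₀)
    (hball : closedBall s₀ (2 * ρ₀) ⊆ S)
    (z₀ : EuclideanSpace ℂ (Fin n)) :
    ∃ c₀ : ℝ, ∀ t ∈ closedBall s₀ ρ₀, ∀ z : EuclideanSpace ℂ (Fin n),
      (∀ j, z j ≠ 0) → z ≠ z₀ →
      ρ₀ * Real.log ‖z - z₀‖ + (∑ j, t j * Real.log ‖z j‖) + c₀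
        ≤ sSup ((fun s : EuclideanSpace ℝ (Fin n) => ∑ j, s j * Real.log ‖z j‖) '' S) := by
  set C : ℝ := √n + ‖z₀‖ + 1 with hC
  have hC_pos : 0 < C := by positivity
  refine ⟨-(ρ₀ * Real.log C), fun t ht z hz hne => ?_⟩
  have hbdd : BddAbove ((fun s : EuclideanSpace ℝ (Fin n) => ∑ j, s j * Real.log ‖z j‖) '' S) :=
    hS.bddAbove_image (Continuous.continuousOn (by fun_prop))
  have hsub : ∀ v : EuclideanSpace ℝ (Fin n), ‖v‖ ≤ ρ₀ → t + v ∈ S := fun v hv => by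
    refine hball ?_
    rw [mem_closedBall, dist_eq_norm] at ht ⊢
    calc ‖t + v - s₀‖ = ‖(t - s₀) + v‖ := by congr 1; abel
      _ ≤ ‖t - s₀‖ + ‖v‖ := norm_add_le _ _
      _ ≤ 2 * ρ₀ := by linarith
  have hlog : ∀ r : ℝ, 1 ≤ r → (∀ j, ‖z j‖ ≤ r) →
      Real.log ‖z - z₀‖ ≤ Real.log C + Real.log r := fun r hr h => by
    rw [← Real.log_mul hC_pos.ne' (by positivity)]
    refine Real.log_le_log (norm_pos_iff.2 (sub_ne_zero.2 hne)) ?_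
    have h1 := EuclideanSpace.norm_le_sqrt_mul z (by linarith) h
    have h2 := norm_sub_le z z₀
    have h3 : ‖z₀‖ ≤ ‖z₀‖ * r := le_mul_of_one_le_right (norm_nonneg _) hr
    rw [hC]
    linarith
  by_cases h : ∀ j, ‖z j‖ ≤ 1
  · have hle := le_csSup hbdd (Set.mem_image_of_mem _ (hsub 0 (by simpa using hρ₀.le)))
    have := mul_le_mul_of_nonneg_left (hlog 1 le_rfl h) hρ₀.le
    simp only [add_zero, Real.log_one] at hle this
    linarith
  · push Not at h
    obtain ⟨i, hi⟩ := h
    obtain ⟨k, -, hk⟩ := Finset.exists_max_image Finset.univ (fun j => ‖z j‖) ⟨i, Finset.mem_univ i⟩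
    have hle := le_csSup hbdd (Set.mem_image_of_mem _
      (hsub (EuclideanSpace.single k ρ₀) (by simp [abs_of_pos hρ₀])))
    have := mul_le_mul_of_nonneg_left
      (hlog ‖z k‖ (hi.le.trans (hk i (Finset.mem_univ i))) fun j => hk j (Finset.mem_univ j)) hρ₀.le
    have hsum : ∑ j, (t + EuclideanSpace.single k ρ₀) j * Real.log ‖z j‖ =
        ∑ j, t j * Real.log ‖z j‖ + ρ₀ * Real.log ‖z k‖ := by
      simp [add_mul, Finset.sum_add_distrib]
    simp only [hsum] at hle
    linarith
end
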